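/- Let h(x) = a·x^d + c ∈ F_q[x] with a ≠ 0 and d ≥ 2, and let β ∈ F_q. Suppose q ≡ 1 (mod r) for every prime r dividing d, and if 4 divides d suppose q ≡ 1 (mod 4). Then the pair (h, β) is dynamically irreducible over F_q if and only if: for every prime r dividing d, −(c − β)/a is not an r-th power in F_q and (h^{n−1}(c) − β)/a is not an r-th power in F_q for all integers n > 1; and, if 4 divides d, additionally (c − β)/(4a) is not a 4-th power in F_q and (h^{n−1}(c) − β)/a is not a 4-th power in F_q for all integers n > 1. -/

import Mathlib

open Polynomial

/-- The `n`-fold composition `f ∘ f ∘ ... ∘ f` (`n` times) of a polynomial,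
with `f^0 = X` (the identity). -/
noncomputable def polyIter {K : Type*} [Field K] (f : K[X]) : ℕ → K[X]
  | 0 => X
  | n + 1 => f.comp (polyIter f n)

section FiniteFieldPowers

/-- In a finite field `L`, if `p` divides `#L - 1`, then the nonzero `p`-th powers are exactly the
elements killed by `(#L - 1) / p`; this is the nontrivial inclusion. -/
theorem exists_pow_eq_of_pow_card_sub_one_div_eq_one {L : Type*} [Field L] [Finite L] {p : ℕ}
    (hp : p ∣ Nat.card L - 1) {x : L} (hx : x ≠ 0) (h1 : x ^ ((Nat.card L - 1) / p) = 1) :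
    ∃ y : L, y ^ p = x := by
  obtain ⟨g, hg⟩ := IsCyclic.exists_generator (α := Lˣ)
  obtain ⟨k, hk⟩ := mem_powers_iff_mem_zpowers.mpr (hg (Units.mk0 x hx))
  have hord : orderOf g = Nat.card L - 1 := by
    rw [orderOf_eq_card_of_forall_mem_zpowers hg, Nat.card_units]
  have hpos : 0 < Nat.card L - 1 := hord ▸ orderOf_pos g
  obtain ⟨m, hm⟩ := hp
  have hp0 : 0 < p := Nat.pos_of_ne_zero fun h => by simp [h] at hm; omega
  have hm0 : 0 < m := Nat.pos_of_ne_zero fun h => by simp [h] at hm; omega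
  rw [hm, Nat.mul_div_cancel_left m hp0] at h1
  have hgk : g ^ (k * m) = 1 := by
    rw [pow_mul]
    have hk' : g ^ k = Units.mk0 x hx := hk
    rw [hk']
    ext
    simpa using h1
  have hdvd := orderOf_dvd_of_pow_eq_one hgk
  rw [hord, hm] at hdvd
  obtain ⟨j, rfl⟩ := Nat.dvd_of_mul_dvd_mul_right hm0 hdvd
  refine ⟨((g ^ j : Lˣ) : L), ?_⟩
  rw [← Units.val_pow_eq_pow_val, ← pow_mul, mul_comm]
  exact congrArg Units.val hk

/-- In an extension of finite fields `L / K` with `#K ≡ 1 (mod p)`, an element of `L` whose norm is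
a `p`-th power in `K` is a `p`-th power in `L`. -/
theorem exists_pow_eq_of_norm_eq_pow {K L : Type*} [Field K] [Field L] [Algebra K L] [Finite K]
    [Finite L] {p : ℕ} (hp : p ∣ Nat.card K - 1) (hp0 : p ≠ 0) {x : L} {w : K}
    (hw : w ^ p = Algebra.norm K x) : ∃ y : L, y ^ p = x := by
  rcases eq_or_ne x 0 with rfl | hx
  · exact ⟨0, zero_pow hp0⟩
  have hN : Algebra.norm K x ≠ 0 := Algebra.norm_ne_zero_iff.mpr hx
  have hw0 : w ≠ 0 := by
    rintro rfl
    exact hN (by rw [← hw, zero_pow hp0])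
  have hdvd : Nat.card K - 1 ∣ Nat.card L - 1 := by
    rw [Module.natCard_eq_pow_finrank (K := K) (V := L)]
    simpa using Nat.sub_dvd_pow_sub_pow (Nat.card K) 1 (Module.finrank K L)
  refine exists_pow_eq_of_pow_card_sub_one_div_eq_one (hp.trans hdvd) hx ?_
  have hK : 0 < Nat.card K - 1 := Nat.sub_pos_of_lt Finite.one_lt_card
  have hexp : (Nat.card L - 1) / p =
      (Nat.card L - 1) / (Nat.card K - 1) * ((Nat.card K - 1) / p) := by
    rw [Nat.div_mul_div_comm hdvd hp, mul_comm (Nat.card K - 1), Nat.mul_div_mul_right _ _ hK]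
  rw [hexp, pow_mul, ← FiniteField.algebraMap_norm_eq_pow, ← hw, ← map_pow, ← pow_mul,
    Nat.mul_div_cancel' hp]
  have := Fintype.ofFinite K
  rw [Nat.card_eq_fintype_card, FiniteField.pow_card_sub_one_eq_one w hw0, map_one]

end FiniteFieldPowers

section Expand

variable {K : Type*} [Field K]

theorem AdjoinRoot.norm_root_of_monic {g : K[X]} (hg : g.Monic) :
    Algebra.norm K (AdjoinRoot.root g) = (-1) ^ g.natDegree * g.coeff 0 := by
  have := Algebra.PowerBasis.norm_gen_eq_coeff_zero_minpoly (AdjoinRoot.powerBasis hg.ne_zero)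
  rwa [AdjoinRoot.minpoly_powerBasis_gen_of_monic hg, AdjoinRoot.powerBasis_gen,
    AdjoinRoot.powerBasis_dim] at this

theorem irreducible_expand_of_forall_pow_ne {g : K[X]} (hg : g.Monic) (hirr : Irreducible g)
    {p : ℕ} (hp : p.Prime) (h : ∀ w : K, w ^ p ≠ (-1) ^ g.natDegree * g.coeff 0) :
    Irreducible (expand K p g) := by
  rw [expand_eq_comp_X_pow]
  refine irreducible_comp hg (monic_X_pow p) hirr fun E _ _ x hx => ?_
  rw [Polynomial.map_pow, map_X]
  refine X_pow_sub_C_irreducible_of_prime hp fun b hb => h (Algebra.norm K b) ?_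
  have hint : IsIntegral K x := by
    by_contra hcon
    exact hg.ne_zero (hx ▸ minpoly.eq_zero hcon)
  have := Algebra.PowerBasis.norm_gen_eq_coeff_zero_minpoly
    (IntermediateField.adjoin.powerBasis hint)
  rw [IntermediateField.adjoin.powerBasis_gen, IntermediateField.minpoly_gen, hx,
    IntermediateField.adjoin.powerBasis_dim, hx] at this
  rw [← map_pow, hb, this]

theorem pow_ne_of_irreducible_expand [Finite K] {g : K[X]} (hg : g.Monic) {p : ℕ}
    (hp : p.Prime) (hpK : p ∣ Nat.card K - 1) (h : Irreducible (expand K p g)) (w : K) :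
    w ^ p ≠ (-1) ^ g.natDegree * g.coeff 0 := by
  intro hw
  have : Fact (Irreducible g) := ⟨of_irreducible_expand hp.ne_zero h⟩
  have := (AdjoinRoot.powerBasis hg.ne_zero).finite
  have : Finite (AdjoinRoot g) := Module.finite_of_finite K
  rw [← AdjoinRoot.norm_root_of_monic hg] at hw
  obtain ⟨y, hy⟩ := exists_pow_eq_of_norm_eq_pow hpK hp.ne_zero hw
  have hroot : aeval y (expand K p g) = 0 := by
    rw [expand_aeval, hy, AdjoinRoot.aeval_eq, AdjoinRoot.mk_self]
  have hmin := minpoly.eq_of_irreducible_of_monic h hroot ((monic_expand_iff hp.pos).mpr hg)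
  have hle := minpoly.natDegree_le (A := K) y
  rw [← hmin, natDegree_expand, (AdjoinRoot.powerBasis hg.ne_zero).finrank,
    AdjoinRoot.powerBasis_dim] at hle
  have hpos := Fact.out (p := Irreducible g) |>.natDegree_pos
  have := hp.two_le
  nlinarith

/-- If `p` is odd, or if `p = 2` and `-1` is a square when the exponent is even, the sign changes
introduced by repeated substitutions `X ↦ X ^ k` are harmless. -/
theorem exists_neg_one_pow_mul_eq_pow_mul {p k m : ℕ} (hp : p.Prime)
    (h4 : p = 2 → Even k → ∃ i : K, i ^ 2 = -1) :
    ∃ u : K, u ≠ 0 ∧ (-1) ^ (m * k) = u ^ p * (-1) ^ m := by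
  rcases hp.eq_two_or_odd' with rfl | hodd
  · rcases Nat.even_or_odd k with hk | hk
    · obtain ⟨i, hi⟩ := h4 rfl hk
      refine ⟨i ^ m, pow_ne_zero _ fun h0 => by simp [h0] at hi, ?_⟩
      rw [(hk.mul_left m).neg_one_pow, ← pow_mul, mul_comm m 2, pow_mul, hi, ← mul_pow]
      simp
    · refine ⟨1, one_ne_zero, ?_⟩
      rw [mul_comm, pow_mul, hk.neg_one_pow]
      simp
  · refine ⟨(-1) ^ (m * k + m), pow_ne_zero _ (by simp), ?_⟩
    rw [← pow_mul, mul_comm _ p, pow_mul (-1 : K) p, hodd.neg_one_pow, ← pow_add, add_assoc,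
      ← two_mul, pow_add, pow_mul (-1 : K) 2]
    simp

theorem irreducible_expand_iff_of_monic [Finite K] {g : K[X]} (hg : g.Monic) {d : ℕ} (hd : d ≠ 0)
    (hcong : ∀ r : ℕ, r.Prime → r ∣ d → r ∣ Nat.card K - 1)
    (hcong4 : 4 ∣ d → ∃ i : K, i ^ 2 = -1) :
    Irreducible (expand K d g) ↔ Irreducible g ∧
      ∀ r : ℕ, r.Prime → r ∣ d → ∀ w : K, w ^ r ≠ (-1) ^ g.natDegree * g.coeff 0 := by
  constructor
  · refine fun h => ⟨of_irreducible_expand hd h, fun r hr hrd => ?_⟩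
    refine pow_ne_of_irreducible_expand hg hr (hcong r hr hrd) ?_
    obtain ⟨k, rfl⟩ := hrd
    rw [mul_comm, expand_mul] at h
    exact of_irreducible_expand (right_ne_zero_of_mul hd) h
  · rintro ⟨hirr, hpow⟩
    induction d using induction_on_primes with
    | zero => exact absurd rfl hd
    | one => rwa [expand_one]
    | prime_mul p k hp ih =>
      have hk : k ≠ 0 := right_ne_zero_of_mul hd
      have hgk := ih hk (fun r hr hrk => hcong r hr (hrk.mul_left p))
        (fun h => hcong4 (h.mul_left p)) (fun r hr hrk => hpow r hr (hrk.mul_left p))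
      rw [expand_mul]
      refine irreducible_expand_of_forall_pow_ne ((monic_expand_iff hk.bot_lt).mpr hg) hgk hp ?_
      intro w hw
      obtain ⟨u, hu, hsign⟩ := exists_neg_one_pow_mul_eq_pow_mul (K := K) (m := g.natDegree)
        (k := k) hp fun h2 hev => hcong4 <| by
          obtain ⟨j, rfl⟩ := hev.two_dvd
          exact ⟨j, by rw [h2]; ring⟩
      rw [natDegree_expand, coeff_expand hk.bot_lt, if_pos (dvd_zero k), Nat.zero_div, hsign] at hw
      refine hpow p hp (dvd_mul_right p k) (w / u) ?_
      rw [div_pow, hw]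
      field_simp

theorem irreducible_expand_iff [Finite K] {g : K[X]} (hg : g ≠ 0) {d : ℕ} (hd : d ≠ 0)
    (hcong : ∀ r : ℕ, r.Prime → r ∣ d → r ∣ Nat.card K - 1)
    (hcong4 : 4 ∣ d → ∃ i : K, i ^ 2 = -1) :
    Irreducible (expand K d g) ↔ Irreducible g ∧ ∀ r : ℕ, r.Prime → r ∣ d →
      ∀ w : K, w ^ r ≠ (-1) ^ g.natDegree * g.coeff 0 / g.leadingCoeff := by
  have hlc : g.leadingCoeff⁻¹ ≠ 0 := inv_ne_zero (leadingCoeff_ne_zero.mpr hg)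
  have hunit : IsUnit (C g.leadingCoeff⁻¹) := isUnit_C.mpr hlc.isUnit
  have key := irreducible_expand_iff_of_monic (monic_mul_leadingCoeff_inv hg) hd hcong hcong4
  rw [map_mul, expand_C, irreducible_mul_isUnit hunit, irreducible_mul_isUnit hunit,
    natDegree_mul_C hlc, coeff_mul_C] at key
  simpa only [div_eq_mul_inv, mul_assoc] using key

end Expand

section PolyIter

variable {K : Type*} [Field K]

theorem polyIter_succ' (f : K[X]) (n : ℕ) : polyIter f (n + 1) = (polyIter f n).comp f := by
  induction n with
  | zero => simp [polyIter]
  | succ n ih =>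
    change f.comp (polyIter f (n + 1)) = (f.comp (polyIter f n)).comp f
    rw [ih, comp_assoc]

theorem eval_polyIter (f : K[X]) (n : ℕ) (x : K) :
    (polyIter f n).eval x = (fun t => f.eval t)^[n] x := by
  induction n with
  | zero => simp [polyIter]
  | succ n ih => rw [polyIter, eval_comp, ih, Function.iterate_succ_apply']

theorem natDegree_polyIter (f : K[X]) (n : ℕ) :
    (polyIter f n).natDegree = f.natDegree ^ n := by
  induction n with
  | zero => simp [polyIter]
  | succ n ih => rw [polyIter, natDegree_comp, ih, pow_succ']

theorem leadingCoeff_polyIter_succ (f : K[X]) (hf : f.natDegree ≠ 0) (n : ℕ) :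
    (polyIter f (n + 1)).leadingCoeff =
      f.leadingCoeff * (polyIter f n).leadingCoeff ^ f.natDegree := by
  rw [polyIter, leadingCoeff_comp]
  rw [natDegree_polyIter]
  exact pow_ne_zero _ hf

theorem irreducible_comp_C_mul_X_add_C_iff {a : K} (ha : a ≠ 0) (c : K) (f : K[X]) :
    Irreducible (f.comp (C a * X + C c)) ↔ Irreducible f := by
  have := invertibleOfNonzero ha
  exact MulEquiv.irreducible_iff (algEquivCMulXAddC a c)

end PolyIter

/-- One step of the iteration: `f ∘ (a X ^ d + c)` is irreducible iff `f` is and the norm of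
`(α - c) / a`, for `α` a root of `f`, is not an `r`-th power for any prime `r ∣ d`. -/
theorem irreducible_comp_C_mul_X_pow_add_C_iff {K : Type*} [Field K] [Finite K] {f : K[X]}
    (hf : f ≠ 0) {d : ℕ} (hd : d ≠ 0) {a : K} (ha : a ≠ 0) (c : K)
    (hcong : ∀ r : ℕ, r.Prime → r ∣ d → r ∣ Nat.card K - 1)
    (hcong4 : 4 ∣ d → ∃ i : K, i ^ 2 = -1) :
    Irreducible (f.comp (C a * X ^ d + C c)) ↔ Irreducible f ∧ ∀ r : ℕ, r.Prime → r ∣ d →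
      ∀ w : K, w ^ r ≠
        (-1) ^ f.natDegree * f.eval c / (f.leadingCoeff * a ^ f.natDegree) := by
  have hlin : (C a * X + C c : K[X]).natDegree = 1 := natDegree_linear ha
  have hexp : f.comp (C a * X ^ d + C c) = expand K d (f.comp (C a * X + C c)) := by
    simp [expand_eq_comp_X_pow, comp_assoc]
  have hne : f.comp (C a * X + C c) ≠ 0 := by
    rw [← leadingCoeff_ne_zero, leadingCoeff_comp (by simp [hlin]), leadingCoeff_linear ha]
    exact mul_ne_zero (leadingCoeff_ne_zero.mpr hf) (pow_ne_zero _ ha)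
  rw [hexp, irreducible_expand_iff hne hd hcong hcong4, irreducible_comp_C_mul_X_add_C_iff ha,
    natDegree_comp, hlin, mul_one, leadingCoeff_comp (by simp [hlin]), leadingCoeff_linear ha,
    coeff_zero_eq_eval_zero, eval_comp]
  simp

theorem exists_pow_eq_mul_iff {K : Type*} [Field K] {r : ℕ} {u : K} (hu : u ≠ 0) (x : K) :
    (∃ v : K, v ^ r = u ^ r * x) ↔ ∃ v : K, v ^ r = x := by
  constructor
  · rintro ⟨v, hv⟩
    exact ⟨v / u, by rw [div_pow, hv, mul_div_cancel_left₀ _ (pow_ne_zero _ hu)]⟩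
  · rintro ⟨v, rfl⟩
    exact ⟨u * v, mul_pow u v r⟩

theorem stmt1 {K : Type*} [Field K] [Fintype K] {q d : ℕ}
    (hq : Fintype.card K = q) (hd : 2 ≤ d)
    (a c β : K) (ha : a ≠ 0) (h : K[X]) (hh : h = C a * X ^ d + C c)
    (hcong : ∀ r : ℕ, r.Prime → r ∣ d → q % r = 1)
    (hcong4 : 4 ∣ d → q % 4 = 1) :
    (∀ n : ℕ, 0 < n → Irreducible (polyIter h n - C β)) ↔
      ((∀ r : ℕ, r.Prime → r ∣ d →
          (¬ ∃ v : K, v ^ r = -(c - β) / a) ∧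
          ∀ n : ℕ, 1 < n → ¬ ∃ v : K, v ^ r = ((fun t => h.eval t)^[n - 1] c - β) / a) ∧
       (4 ∣ d →
          (¬ ∃ v : K, v ^ 4 = (c - β) / (4 * a)) ∧
          ∀ n : ℕ, 1 < n → ¬ ∃ v : K, v ^ 4 = ((fun t => h.eval t)^[n - 1] c - β) / a)) := by
  have hd0 : d ≠ 0 := by omega
  have hcard : Nat.card K = q := by rw [Nat.card_eq_fintype_card, hq]
  have hdvd : ∀ r : ℕ, r.Prime → r ∣ d → r ∣ Nat.card K - 1 := by
    intro r hr hrd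
    rw [hcard]
    exact (Nat.modEq_iff_dvd' (hq ▸ Fintype.card_pos)).mp
      ((Nat.mod_eq_of_lt hr.one_lt).trans (hcong r hr hrd).symm)
  have hi : 4 ∣ d → ∃ i : K, i ^ 2 = -1 := by
    intro h4
    obtain ⟨i, hi⟩ := FiniteField.isSquare_neg_one_iff.mpr
      (show Fintype.card K % 4 ≠ 3 by rw [hq, hcong4 h4]; decide)
    exact ⟨i, by rw [hi, sq]⟩
  have hdeg : h.natDegree = d := by
    rw [hh, natDegree_add_C, natDegree_C_mul_X_pow d a ha]
  have hlead : h.leadingCoeff = a := by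
    rw [leadingCoeff, hdeg, hh]
    simp [coeff_C, hd0]
  have hdeg' (n : ℕ) : (polyIter h n - C β).natDegree = d ^ n := by
    rw [natDegree_sub_C, natDegree_polyIter, hdeg]
  have hlead' (n : ℕ) : (polyIter h n - C β).leadingCoeff = (polyIter h n).leadingCoeff := by
    apply leadingCoeff_sub_of_degree_lt
    refine degree_C_le.trans_lt (natDegree_pos_iff_degree_pos.mp ?_)
    rw [natDegree_polyIter, hdeg]
    positivity
  have hlead0 (n : ℕ) : (polyIter h n).leadingCoeff ≠ 0 := by
    rw [leadingCoeff_ne_zero]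
    refine ne_zero_of_natDegree_gt (n := 0) ?_
    rw [natDegree_polyIter, hdeg]
    positivity
  have hne (n : ℕ) : polyIter h n - C β ≠ 0 := by
    rw [← leadingCoeff_ne_zero, hlead']
    exact hlead0 n
  have hstep (n : ℕ) : Irreducible (polyIter h (n + 1) - C β) ↔
      Irreducible (polyIter h n - C β) ∧ ∀ r : ℕ, r.Prime → r ∣ d → ∀ w : K, w ^ r ≠
        (-1) ^ d ^ n * ((fun t => h.eval t)^[n] c - β) /
          ((polyIter h n).leadingCoeff * a ^ d ^ n) := by
    have := irreducible_comp_C_mul_X_pow_add_C_iff (hne n) hd0 ha c hdvd hi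
    rw [← hh, sub_comp, ← polyIter_succ', C_comp, hdeg', hlead', eval_sub, eval_C,
      eval_polyIter] at this
    exact this
  have hzero (r : ℕ) : (∃ w : K, w ^ r = (-1) ^ d ^ 0 * ((fun t => h.eval t)^[0] c - β) /
        ((polyIter h 0).leadingCoeff * a ^ d ^ 0)) ↔ ∃ v : K, v ^ r = -(c - β) / a := by
    simp [polyIter]
  have hsucc (n r : ℕ) (hrd : r ∣ d) :
      (∃ w : K, w ^ r = (-1) ^ d ^ (n + 1) * ((fun t => h.eval t)^[n + 1] c - β) /
        ((polyIter h (n + 1)).leadingCoeff * a ^ d ^ (n + 1))) ↔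
      ∃ v : K, v ^ r = ((fun t => h.eval t)^[n + 1] c - β) / a := by
    obtain ⟨k, hk⟩ := hrd
    have hL := hlead0 n
    have hu : (((-1) ^ d ^ n / ((polyIter h n).leadingCoeff * a ^ d ^ n)) ^ k : K) ≠ 0 :=
      pow_ne_zero _ (div_ne_zero (pow_ne_zero _ (by simp)) (mul_ne_zero hL (pow_ne_zero _ ha)))
    rw [← exists_pow_eq_mul_iff hu (((fun t => h.eval t)^[n + 1] c - β) / a), ← pow_mul,
      mul_comm k r, ← hk, leadingCoeff_polyIter_succ h (hdeg ▸ hd0), hlead, hdeg, pow_succ d n,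
      pow_mul, pow_mul, div_pow, mul_pow, div_mul_div_comm, mul_comm _ a, ← mul_assoc a]
  have hsq : (∀ r : ℕ, r.Prime → r ∣ d →
      (¬ ∃ v : K, v ^ r = -(c - β) / a) ∧
      ∀ n : ℕ, 1 < n → ¬ ∃ v : K, v ^ r = ((fun t => h.eval t)^[n - 1] c - β) / a) →
      4 ∣ d → (¬ ∃ v : K, v ^ 4 = (c - β) / (4 * a)) ∧
      ∀ n : ℕ, 1 < n → ¬ ∃ v : K, v ^ 4 = ((fun t => h.eval t)^[n - 1] c - β) / a := by
    intro hall h4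
    obtain ⟨h1, h2⟩ := hall 2 Nat.prime_two ((by norm_num : 2 ∣ 4).trans h4)
    refine ⟨?_, ?_⟩
    · rintro ⟨v, hv⟩
      obtain ⟨i, hi⟩ := hi h4
      have hfour : (4 : K) ≠ 0 := by
        have hchar : ringChar K ≠ 2 := by
          rw [Ne, FiniteField.even_card_iff_char_two, hq]
          have := hcong4 h4
          omega
        have : (2 : K) ≠ 0 := Ring.two_ne_zero hchar
        rw [show (4 : K) = 2 * 2 by norm_num]
        exact mul_ne_zero this this
      refine h1 ⟨2 * i * v ^ 2, ?_⟩
      have hv' : (c - β) / a = 4 * v ^ 4 := by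
        rw [hv]
        field_simp
      rw [neg_div, hv', mul_pow, mul_pow, hi]
      ring
    · rintro n hn ⟨v, hv⟩
      exact h2 n hn ⟨v ^ 2, by rw [← hv]; ring⟩
  rw [and_iff_left_of_imp hsq]
  constructor
  · refine fun hirr r hr hrd => ⟨?_, fun n hn => ?_⟩
    · rw [← hzero r]
      rintro ⟨w, hw⟩
      exact ((hstep 0).mp (hirr 1 one_pos)).2 r hr hrd w hw
    · obtain ⟨m, rfl⟩ : ∃ m, n = m + 2 := ⟨n - 2, by omega⟩
      rw [show m + 2 - 1 = m + 1 by omega, ← hsucc m r hrd]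
      rintro ⟨w, hw⟩
      exact ((hstep (m + 1)).mp (hirr (m + 2) (by omega))).2 r hr hrd w hw
  · intro hall n _
    induction n with
    | zero => simpa [polyIter] using irreducible_X_sub_C β
    | succ n ih =>
      have hn : Irreducible (polyIter h n - C β) := by
        rcases Nat.eq_zero_or_pos n with rfl | hpos
        · simpa [polyIter] using irreducible_X_sub_C β
        · exact ih hpos
      refine (hstep n).mpr ⟨hn, fun r hr hrd w hw => ?_⟩
      cases n with
      | zero => exact (hall r hr hrd).1 ((hzero r).mp ⟨w, hw⟩)
      | succ m => exact (hall r hr hrd).2 (m + 2) (by omega) ((hsucc m r hrd).mp ⟨w, hw⟩)
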